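/- There exists a number R₁ > 0 with the following four properties. (1) If l₁ : [0,1/2] → ℝ is C², solves (l₁'/φ₁)' = l₁·sin²(πt/2)/σ on (0,1/2), and satisfies l₁(0) = −1, l₁'(0) = 0 and l₁''(0) = α₁ with α₁ ≥ R₁, then l₁(1/2) > 0. (2) If l₂ : [0,1/2] → ℝ is C², solves (l₂'/φ₂)' = l₂·cos²(πt/2)/σ on (0,1/2), and satisfies l₂(0) = 0 and l₂'(0) = α₂ with α₂ ≥ R₁, then l₂(1/2) > 1. (3) If l₁ : [1/2,1] → ℝ is C², solves (l₁'/φ₁)' = l₁·sin²(πt/2)/σ on (1/2,1), and satisfies l₁(1) = 0 and l₁'(1) = β₁ with β₁ ≥ R₁, then l₁(1/2) < −1. (4) If l₂ : [1/2,1] → ℝ is C², solves (l₂'/φ₂)' = l₂·cos²(πt/2)/σ on (1/2,1), and satisfies l₂(1) = 1, l₂'(1) = 0 and l₂''(1) = −β₂ with β₂ ≥ R₁, then l₂(1/2) < 0. (All endpoint derivatives are one-sided.) -/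

import Mathlib

open Set Filter Topology

/-- `l` is a C² solution on `[0,1/2]` of `(l'/φ)' = l Q`. -/
def SolE (φ Q l : ℝ → ℝ) : Prop :=
  ContDiffOn ℝ 2 l (Icc 0 (1 / 2)) ∧
    ∀ t ∈ Ioo (0 : ℝ) (1 / 2), deriv (fun s => deriv l s / φ s) t = l t * Q t

lemma diff_of_C2 {a b : ℝ} {l : ℝ → ℝ} (h : ContDiffOn ℝ 2 l (Icc a b)) {t : ℝ}
    (ht : t ∈ Ioo a b) : DifferentiableAt ℝ l t ∧ DifferentiableAt ℝ (deriv l) t := by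
  have h1 : ContDiffAt ℝ 2 l t := h.contDiffAt (Icc_mem_nhds ht.1 ht.2)
  refine ⟨h1.differentiableAt (by norm_num), ?_⟩
  have h2 : ContDiffOn ℝ 1 (deriv l) (Ioo a b) :=
    (h.mono Ioo_subset_Icc_self).deriv_of_isOpen isOpen_Ioo (by norm_num)
  exact (h2.contDiffAt (Ioo_mem_nhds ht.1 ht.2)).differentiableAt (by norm_num)

lemma derivWithin_C1 {a b : ℝ} (hab : a < b) {l : ℝ → ℝ} (h : ContDiffOn ℝ 2 l (Icc a b)) :
    ContDiffOn ℝ 1 (derivWithin l (Icc a b)) (Icc a b) :=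
  h.derivWithin (uniqueDiffOn_Icc hab) (by norm_num)

lemma dw_eq {a b : ℝ} (l : ℝ → ℝ) {t : ℝ}
    (ht : t ∈ Ioo a b) : derivWithin l (Icc a b) t = deriv l t :=
  derivWithin_of_mem_nhds (Icc_mem_nhds ht.1 ht.2)

lemma pos_lemma {φ Q d : ℝ → ℝ} (hφ : ∀ t ∈ Ioo (0 : ℝ) (1 / 2), 0 < φ t)
    (hφd : ∀ t ∈ Ioo (0 : ℝ) (1 / 2), DifferentiableAt ℝ φ t)
    (hQ : ∀ t ∈ Ioo (0 : ℝ) (1 / 2), 0 ≤ Q t) (hd : SolE φ Q d) (h0 : d 0 = 0)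
    (hpos : ∀ᶠ t in 𝓝[>] (0 : ℝ), 0 < derivWithin d (Icc 0 (1 / 2)) t) :
    0 < d (1 / 2) := by
  obtain ⟨hC, hE⟩ := hd
  obtain ⟨e, he0, he⟩ := (mem_nhdsGT_iff_exists_Ioo_subset).1 hpos
  have he0 : 0 < e := he0
  set t0 : ℝ := min e (1 / 2) / 2 with ht0
  have hm : 0 < min e (1 / 2 : ℝ) := lt_min he0 (by norm_num)
  have ht0p : 0 < t0 := by positivity
  have ht0e : t0 < e := by have := min_le_left e (1 / 2 : ℝ); linarith
  have ht0h : t0 < 1 / 2 := by have := min_le_right e (1 / 2 : ℝ); linarith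
  have hder : ∀ t ∈ Ioc 0 t0, 0 < deriv d t := by
    intro t ht
    rw [← dw_eq d (a := 0) (b := 1 / 2) ⟨ht.1, by linarith [ht.2]⟩]
    exact he ⟨ht.1, by linarith [ht.2]⟩
  have hdt0 : 0 < d t0 := by
    have := strictMonoOn_of_deriv_pos (convex_Icc 0 t0)
      (hC.continuousOn.mono (Icc_subset_Icc le_rfl ht0h.le))
      (fun x hx => hder x (by rw [interior_Icc] at hx; exact ⟨hx.1, hx.2.le⟩))
    have := this (left_mem_Icc.2 ht0p.le) (right_mem_Icc.2 ht0p.le) ht0p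
    rwa [h0] at this
  set u : ℝ → ℝ := fun s => deriv d s / φ s with hu
  have hud : ∀ t ∈ Ioo (0 : ℝ) (1 / 2), HasDerivAt u (d t * Q t) t := by
    intro t ht
    rw [← hE t ht]
    exact ((diff_of_C2 hC ht).2.div (hφd t ht) (hφ t ht).ne').hasDerivAt
  have hdd : ∀ t ∈ Ioo (0 : ℝ) (1 / 2), HasDerivAt d (φ t * u t) t := by
    intro t ht
    have := (diff_of_C2 hC ht).1.hasDerivAt
    have h2 : φ t * u t = deriv d t := by
      have := (hφ t ht).ne'
      simp only [hu]; field_simp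
    rwa [h2]
  have hP : MonotoneOn (fun t => d t * u t) (Ioo (0 : ℝ) (1 / 2)) := by
    have hh : ∀ t ∈ Ioo (0 : ℝ) (1 / 2), HasDerivAt (fun t => d t * u t)
      (φ t * u t * u t + d t * (d t * Q t)) t := fun t ht => (hdd t ht).mul (hud t ht)
    apply monotoneOn_of_deriv_nonneg (convex_Ioo _ _)
    · exact fun t ht => (hh t ht).continuousAt.continuousWithinAt
    · rw [interior_Ioo]
      exact fun t ht => (hh t ht).differentiableAt.differentiableWithinAt
    · rw [interior_Ioo]
      intro t ht
      rw [(hh t ht).deriv]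
      have h1 := hφ t ht
      have h2 := hQ t ht
      nlinarith [mul_nonneg h1.le (mul_self_nonneg (u t)), mul_nonneg h2 (mul_self_nonneg (d t))]
  have hP0 : 0 < d t0 * u t0 :=
    mul_pos hdt0 (div_pos (hder t0 ⟨ht0p, le_rfl⟩) (hφ t0 ⟨ht0p, ht0h⟩))
  have hsq : MonotoneOn (fun t => d t * d t) (Icc t0 (1 / 2)) := by
    have hc : ContinuousOn d (Icc t0 (1 / 2)) :=
      hC.continuousOn.mono (Icc_subset_Icc ht0p.le le_rfl)
    have hh : ∀ t ∈ Ioo t0 (1 / 2), HasDerivAt (fun t => d t * d t)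
      (φ t * u t * d t + d t * (φ t * u t)) t := fun t ht =>
        (hdd t ⟨ht0p.trans ht.1, ht.2⟩).mul (hdd t ⟨ht0p.trans ht.1, ht.2⟩)
    apply monotoneOn_of_deriv_nonneg (convex_Icc _ _)
    · exact hc.mul hc
    · rw [interior_Icc]
      exact fun t ht => (hh t ht).differentiableAt.differentiableWithinAt
    · rw [interior_Icc]
      intro t ht
      rw [(hh t ht).deriv]
      have ht' : t ∈ Ioo (0 : ℝ) (1 / 2) := ⟨ht0p.trans ht.1, ht.2⟩
      have h1 := hφ t ht'
      have h2 : d t0 * u t0 ≤ d t * u t := hP ⟨ht0p, ht0h⟩ ht' ht.1.le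
      nlinarith [mul_nonneg h1.le (hP0.le.trans h2)]
  by_contra hneg
  push Not at hneg
  have hc : ContinuousOn d (Icc t0 (1 / 2)) :=
      hC.continuousOn.mono (Icc_subset_Icc ht0p.le le_rfl)
  obtain ⟨x, hx, hx0⟩ := intermediate_value_Icc' ht0h.le hc ⟨hneg, hdt0.le⟩
  have := hsq (left_mem_Icc.2 ht0h.le) hx hx.1
  simp only [hx0] at this
  nlinarith [mul_pos hdt0 hdt0]

/-- linear combinations -/
lemma sol_comb {φ Q l la lb : ℝ → ℝ} (c : ℝ)
    (hφ : ∀ t ∈ Ioo (0 : ℝ) (1 / 2), 0 < φ t)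
    (hφd : ∀ t ∈ Ioo (0 : ℝ) (1 / 2), DifferentiableAt ℝ φ t)
    (h : SolE φ Q l) (ha : SolE φ Q la) (hb : SolE φ Q lb) :
    SolE φ Q (fun t => l t - la t - c * (lb t - la t)) := by
  refine ⟨(h.1.sub ha.1).sub (contDiffOn_const.mul (hb.1.sub ha.1)), ?_⟩
  intro t ht
  have key : ∀ m, SolE φ Q m → HasDerivAt (fun s => deriv m s / φ s) (m t * Q t) t := by
    intro m hm
    rw [← hm.2 t ht]
    exact ((diff_of_C2 hm.1 ht).2.div (hφd t ht) (hφ t ht).ne').hasDerivAt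
  have h1 := ((key l h).sub (key la ha)).sub (((key lb hb).sub (key la ha)).const_mul c)
  have h2 : (fun s => deriv (fun t => l t - la t - c * (lb t - la t)) s / φ s) =ᶠ[𝓝 t]
      (fun s => deriv l s / φ s - deriv la s / φ s - c * (deriv lb s / φ s - deriv la s / φ s)) := by
    filter_upwards [Ioo_mem_nhds ht.1 ht.2] with s hs
    have e := (((diff_of_C2 h.1 hs).1.hasDerivAt.sub (diff_of_C2 ha.1 hs).1.hasDerivAt).sub
      (((diff_of_C2 hb.1 hs).1.hasDerivAt.sub (diff_of_C2 ha.1 hs).1.hasDerivAt).const_mul c)).deriv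
    have e' : deriv (fun t => l t - la t - c * (lb t - la t)) s
      = deriv l s - deriv la s - c * (deriv lb s - deriv la s) := e
    rw [e']; ring
  rw [h2.deriv_eq]
  refine (HasDerivAt.deriv (f' := (l t - la t - c * (lb t - la t)) * Q t) ?_)
  have e3 : (l t - la t - c * (lb t - la t)) * Q t
      = l t * Q t - la t * Q t - c * (lb t * Q t - la t * Q t) := by ring
  rw [e3]
  exact h1

lemma dw_comb {S : Set ℝ} {x : ℝ} {f g h : ℝ → ℝ} (c : ℝ)
    (hf : DifferentiableWithinAt ℝ f S x) (hg : DifferentiableWithinAt ℝ g S x)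
    (hh : DifferentiableWithinAt ℝ h S x) (hS : UniqueDiffWithinAt ℝ S x) :
    derivWithin (fun t => f t - g t - c * (h t - g t)) S x =
      derivWithin f S x - derivWithin g S x - c * (derivWithin h S x - derivWithin g S x) :=
  ((hf.hasDerivWithinAt.sub hg.hasDerivWithinAt).sub
    ((hh.hasDerivWithinAt.sub hg.hasDerivWithinAt).const_mul c)).derivWithin hS

lemma abstract_R (G : ℝ → (ℝ → ℝ) → Prop) (K : ℝ)
    (H : ∀ a b α c la lb l, G a la → G b lb → G α l → 0 < α - a - c * (b - a) →
      0 < l (1 / 2) - la (1 / 2) - c * (lb (1 / 2) - la (1 / 2))) :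
    ∃ R : ℝ, 0 < R ∧ ∀ α, R ≤ α → ∀ l, G α l → K < l (1 / 2) := by
  by_cases h2 : ∃ a b la lb, G a la ∧ G b lb ∧ a < b
  · obtain ⟨a, b, la, lb, ha, hb, hab⟩ := h2
    have hD : 0 < lb (1 / 2) - la (1 / 2) := by
      have := H a b b 0 la lb lb ha hb hb (by linarith)
      linarith
    set D := lb (1 / 2) - la (1 / 2)
    set c := (K - la (1 / 2)) / D + 1 with hc
    refine ⟨max 1 (a + c * (b - a) + 1), lt_of_lt_of_le one_pos (le_max_left _ _), ?_⟩
    intro α hα l hl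
    have h3 := (le_max_right 1 (a + c * (b - a) + 1)).trans hα
    have h4 := H a b α c la lb l ha hb hl (by linarith)
    have h5 : c * D = K - la (1 / 2) + D := by rw [hc]; field_simp
    change 0 < l (1 / 2) - la (1 / 2) - c * D at h4
    linarith
  · by_cases h1 : ∃ a la, G a la
    · obtain ⟨a, la, ha⟩ := h1
      refine ⟨max 1 (a + 1), lt_of_lt_of_le one_pos (le_max_left _ _), ?_⟩
      intro α hα l hl
      have h3 := (le_max_right 1 (a + 1)).trans hα
      exact absurd ⟨a, α, la, l, ha, hl, by linarith⟩ h2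
    · exact ⟨1, one_pos, fun α _ l hl => absurd ⟨α, l, hl⟩ h1⟩

lemma caseA {φ Q : ℝ → ℝ} (v K : ℝ) (hφ : ∀ t ∈ Ioo (0 : ℝ) (1 / 2), 0 < φ t)
    (hφd : ∀ t ∈ Ioo (0 : ℝ) (1 / 2), DifferentiableAt ℝ φ t)
    (hQ : ∀ t ∈ Ioo (0 : ℝ) (1 / 2), 0 ≤ Q t) :
    ∃ R : ℝ, 0 < R ∧ ∀ α, R ≤ α → ∀ l, (SolE φ Q l ∧ l 0 = v ∧
      derivWithin l (Icc 0 (1 / 2)) 0 = 0 ∧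
      derivWithin (derivWithin l (Icc 0 (1 / 2))) (Icc 0 (1 / 2)) 0 = α) → K < l (1 / 2) := by
  apply abstract_R (fun α l => SolE φ Q l ∧ l 0 = v ∧
      derivWithin l (Icc 0 (1 / 2)) 0 = 0 ∧
      derivWithin (derivWithin l (Icc 0 (1 / 2))) (Icc 0 (1 / 2)) 0 = α)
  rintro a b α c la lb l ⟨sa, a0, a1, a2⟩ ⟨sb, b0, b1, b2⟩ ⟨s, z0, z1, z2⟩ hpos
  have hlt : (0 : ℝ) < 1 / 2 := by norm_num
  have hU := uniqueDiffOn_Icc hlt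
  have h0m : (0 : ℝ) ∈ Icc (0 : ℝ) (1 / 2) := left_mem_Icc.2 hlt.le
  refine pos_lemma hφ hφd hQ (sol_comb c hφ hφd s sa sb) (by simp [a0, b0, z0]) ?_
  have hd1 : ∀ m, SolE φ Q m → ∀ x ∈ Icc (0 : ℝ) (1 / 2),
    DifferentiableWithinAt ℝ m (Icc 0 (1 / 2)) x := fun m hm x hx =>
      hm.1.differentiableOn (by norm_num) x hx
  have hd2 : ∀ m, SolE φ Q m →
    DifferentiableWithinAt ℝ (derivWithin m (Icc 0 (1 / 2))) (Icc 0 (1 / 2)) 0 := fun m hm =>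
      (derivWithin_C1 hlt hm.1).differentiableOn (by norm_num) 0 h0m
  have e1 : ∀ x ∈ Icc (0 : ℝ) (1 / 2), derivWithin (fun t => l t - la t - c * (lb t - la t))
      (Icc 0 (1 / 2)) x = _ := fun x hx =>
    dw_comb c (hd1 l s x hx) (hd1 la sa x hx) (hd1 lb sb x hx) (hU x hx)
  have e2 := dw_comb c (hd2 l s) (hd2 la sa) (hd2 lb sb) (hU 0 h0m)
  rw [z2, a2, b2] at e2
  have hdiff := ((hd2 l s).sub (hd2 la sa)).sub (((hd2 lb sb).sub (hd2 la sa)).const_mul c)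
  set F : ℝ → ℝ := fun t => derivWithin l (Icc 0 (1 / 2)) t - derivWithin la (Icc 0 (1 / 2)) t
    - c * (derivWithin lb (Icc 0 (1 / 2)) t - derivWithin la (Icc 0 (1 / 2)) t) with hF
  have hdiff' : DifferentiableWithinAt ℝ F (Icc 0 (1 / 2)) 0 := hdiff
  have hder := hdiff'.hasDerivWithinAt
  rw [e2] at hder
  have hder2 : HasDerivWithinAt F (α - a - c * (b - a)) (Ioi 0) 0 :=
    hder.mono_of_mem_nhdsWithin (mem_of_superset (Ioo_mem_nhdsGT hlt) Ioo_subset_Icc_self)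
  have ht := (hasDerivWithinAt_iff_tendsto_slope' (by simp)).1 hder2
  have hF0 : F 0 = 0 := by simp only [hF, z1, a1, b1]; ring
  filter_upwards [ht.eventually (lt_mem_nhds hpos), Ioo_mem_nhdsGT hlt] with x hx hx2
  rw [e1 x (Ioo_subset_Icc_self hx2)]
  change 0 < F x
  rw [slope_def_field, hF0] at hx
  have hx3 : 0 < x := hx2.1
  simp only [sub_zero] at hx
  exact (div_pos_iff_of_pos_right hx3).1 hx

lemma caseB {φ Q : ℝ → ℝ} (v K : ℝ) (hφ : ∀ t ∈ Ioo (0 : ℝ) (1 / 2), 0 < φ t)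
    (hφd : ∀ t ∈ Ioo (0 : ℝ) (1 / 2), DifferentiableAt ℝ φ t)
    (hQ : ∀ t ∈ Ioo (0 : ℝ) (1 / 2), 0 ≤ Q t) :
    ∃ R : ℝ, 0 < R ∧ ∀ α, R ≤ α → ∀ l, (SolE φ Q l ∧ l 0 = v ∧
      derivWithin l (Icc 0 (1 / 2)) 0 = α) → K < l (1 / 2) := by
  apply abstract_R (fun α l => SolE φ Q l ∧ l 0 = v ∧
      derivWithin l (Icc 0 (1 / 2)) 0 = α)
  rintro a b α c la lb l ⟨sa, a0, a1⟩ ⟨sb, b0, b1⟩ ⟨s, z0, z1⟩ hpos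
  have hlt : (0 : ℝ) < 1 / 2 := by norm_num
  have hU := uniqueDiffOn_Icc hlt
  have h0m : (0 : ℝ) ∈ Icc (0 : ℝ) (1 / 2) := left_mem_Icc.2 hlt.le
  have S := sol_comb c hφ hφd s sa sb
  refine pos_lemma hφ hφd hQ S (by simp [a0, b0, z0]) ?_
  have hd1 : ∀ m, SolE φ Q m → ∀ x ∈ Icc (0 : ℝ) (1 / 2),
    DifferentiableWithinAt ℝ m (Icc 0 (1 / 2)) x := fun m hm x hx =>
      hm.1.differentiableOn (by norm_num) x hx
  have e1 := dw_comb c (hd1 l s 0 h0m) (hd1 la sa 0 h0m) (hd1 lb sb 0 h0m) (hU 0 h0m)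
  rw [z1, a1, b1] at e1
  have hc := (derivWithin_C1 hlt S.1).continuousOn 0 h0m
  have hc2 := hc.mono_of_mem_nhdsWithin (s := Ioi 0)
    (mem_of_superset (Ioo_mem_nhdsGT hlt) Ioo_subset_Icc_self)
  refine hc2.eventually (lt_mem_nhds ?_)
  rw [e1]; exact hpos

lemma mem_refl {t : ℝ} (ht : t ∈ Ioo (0 : ℝ) (1 / 2)) : 1 - t ∈ Ioo (1 / 2 : ℝ) 1 :=
  ⟨by linarith [ht.2], by linarith [ht.1]⟩

lemma maps_refl : MapsTo (fun t : ℝ => 1 - t) (Icc 0 (1 / 2)) (Icc (1 / 2) 1) :=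
  fun t ht => ⟨by linarith [ht.2], by linarith [ht.1]⟩

lemma dw_refl {f : ℝ → ℝ} {x : ℝ} (hx : x ∈ Icc (0 : ℝ) (1 / 2))
    (hf : DifferentiableWithinAt ℝ f (Icc (1 / 2) 1) (1 - x)) :
    derivWithin (fun t => - f (1 - t)) (Icc 0 (1 / 2)) x
      = derivWithin f (Icc (1 / 2) 1) (1 - x) := by
  have h1 : HasDerivWithinAt (fun t : ℝ => 1 - t) (-1) (Icc 0 (1 / 2)) x :=
    ((hasDerivAt_id x).const_sub 1).hasDerivWithinAt
  have h2 := (HasDerivWithinAt.comp x hf.hasDerivWithinAt h1 maps_refl).neg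
  have h3 := h2.derivWithin (uniqueDiffOn_Icc (by norm_num) x hx)
  simp only [mul_neg, mul_one, neg_neg] at h3
  exact h3

lemma sol_refl {φ Q l : ℝ → ℝ} (hC : ContDiffOn ℝ 2 l (Icc (1 / 2) 1))
    (hE : ∀ t ∈ Ioo (1 / 2 : ℝ) 1, deriv (fun s => deriv l s / φ s) t = l t * Q t) :
    SolE (fun t => φ (1 - t)) (fun t => Q (1 - t)) (fun t => - l (1 - t)) := by
  refine ⟨(hC.comp (contDiff_const.sub contDiff_id).contDiffOn maps_refl).neg, ?_⟩
  intro t ht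
  have e : (fun s => deriv (fun t => - l (1 - t)) s / φ (1 - s))
      = fun s => (fun s => deriv l s / φ s) (1 - s) := by
    funext s
    have : deriv (fun t => - l (1 - t)) s = deriv l (1 - s) := by
      rw [deriv.fun_neg, deriv_comp_const_sub, neg_neg]
    rw [this]
  rw [e, deriv_comp_const_sub (f := fun s => deriv l s / φ s), hE _ (mem_refl ht)]
  ring


/-- large shooting parameters force crossing, `p = 0` system.
Here `y₁, y₂` are smooth on `(-1,2)`, positive on `(0,1)`, with the stated parity and
boundary behaviour, `φ₁ = y₁/y₂`, `φ₂ = y₂/y₁`, `σ = y₁ y₂`.  There exists `R₁ > 0`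
with the four listed properties; all endpoint derivatives are one-sided (taken within
the relevant closed interval). -/
theorem stmt_7 (y₁ y₂ : ℝ → ℝ)
    (hy₁ : ContDiffOn ℝ (⊤ : ℕ∞) y₁ (Set.Ioo (-1 : ℝ) 2))
    (hy₂ : ContDiffOn ℝ (⊤ : ℕ∞) y₂ (Set.Ioo (-1 : ℝ) 2))
    (hy₁pos : ∀ r ∈ Set.Ioo (0 : ℝ) 1, 0 < y₁ r)
    (hy₂pos : ∀ r ∈ Set.Ioo (0 : ℝ) 1, 0 < y₂ r)
    (h₁odd : ∀ t ∈ Set.Ioo (-1 : ℝ) 1, y₁ (-t) = - y₁ t)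
    (h₁even : ∀ t ∈ Set.Ioo (-1 : ℝ) 1, y₁ (1 + t) = y₁ (1 - t))
    (h₂even : ∀ t ∈ Set.Ioo (-1 : ℝ) 1, y₂ (-t) = y₂ t)
    (h₂odd : ∀ t ∈ Set.Ioo (-1 : ℝ) 1, y₂ (1 + t) = - y₂ (1 - t))
    (hy₁'0 : deriv y₁ 0 = 1) (hy₁1 : 0 < y₁ 1) (hy₂0 : 0 < y₂ 0)
    (hy₂'1 : deriv y₂ 1 = -1) :
    ∃ R₁ : ℝ, 0 < R₁ ∧
      (∀ α₁ : ℝ, R₁ ≤ α₁ → ∀ l₁ : ℝ → ℝ,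
        ContDiffOn ℝ 2 l₁ (Set.Icc 0 (1 / 2)) →
        (∀ t ∈ Set.Ioo (0 : ℝ) (1 / 2),
          deriv (fun s => deriv l₁ s / (y₁ s / y₂ s)) t
            = l₁ t * Real.sin (Real.pi * t / 2) ^ 2 / (y₁ t * y₂ t)) →
        l₁ 0 = -1 → derivWithin l₁ (Set.Icc 0 (1 / 2)) 0 = 0 →
        derivWithin (derivWithin l₁ (Set.Icc 0 (1 / 2))) (Set.Icc 0 (1 / 2)) 0 = α₁ →
        0 < l₁ (1 / 2)) ∧
      (∀ α₂ : ℝ, R₁ ≤ α₂ → ∀ l₂ : ℝ → ℝ,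
        ContDiffOn ℝ 2 l₂ (Set.Icc 0 (1 / 2)) →
        (∀ t ∈ Set.Ioo (0 : ℝ) (1 / 2),
          deriv (fun s => deriv l₂ s / (y₂ s / y₁ s)) t
            = l₂ t * Real.cos (Real.pi * t / 2) ^ 2 / (y₁ t * y₂ t)) →
        l₂ 0 = 0 → derivWithin l₂ (Set.Icc 0 (1 / 2)) 0 = α₂ →
        1 < l₂ (1 / 2)) ∧
      (∀ β₁ : ℝ, R₁ ≤ β₁ → ∀ l₁ : ℝ → ℝ,
        ContDiffOn ℝ 2 l₁ (Set.Icc (1 / 2) 1) →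
        (∀ t ∈ Set.Ioo (1 / 2 : ℝ) 1,
          deriv (fun s => deriv l₁ s / (y₁ s / y₂ s)) t
            = l₁ t * Real.sin (Real.pi * t / 2) ^ 2 / (y₁ t * y₂ t)) →
        l₁ 1 = 0 → derivWithin l₁ (Set.Icc (1 / 2) 1) 1 = β₁ →
        l₁ (1 / 2) < -1) ∧
      (∀ β₂ : ℝ, R₁ ≤ β₂ → ∀ l₂ : ℝ → ℝ,
        ContDiffOn ℝ 2 l₂ (Set.Icc (1 / 2) 1) →
        (∀ t ∈ Set.Ioo (1 / 2 : ℝ) 1,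
          deriv (fun s => deriv l₂ s / (y₂ s / y₁ s)) t
            = l₂ t * Real.cos (Real.pi * t / 2) ^ 2 / (y₁ t * y₂ t)) →
        l₂ 1 = 1 → derivWithin l₂ (Set.Icc (1 / 2) 1) 1 = 0 →
        derivWithin (derivWithin l₂ (Set.Icc (1 / 2) 1)) (Set.Icc (1 / 2) 1) 1 = -β₂ →
        l₂ (1 / 2) < 0) := by
  have hd₁ : ∀ t ∈ Ioo (0 : ℝ) 1, DifferentiableAt ℝ y₁ t := fun t ht =>
    (hy₁.contDiffAt (Ioo_mem_nhds (by linarith [ht.1]) (by linarith [ht.2]))).differentiableAt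
      (by simp)
  have hd₂ : ∀ t ∈ Ioo (0 : ℝ) 1, DifferentiableAt ℝ y₂ t := fun t ht =>
    (hy₂.contDiffAt (Ioo_mem_nhds (by linarith [ht.1]) (by linarith [ht.2]))).differentiableAt
      (by simp)
  have i1 : ∀ t ∈ Ioo (0 : ℝ) (1 / 2), t ∈ Ioo (0 : ℝ) 1 := fun t ht =>
    ⟨ht.1, by linarith [ht.2]⟩
  have i2 : ∀ t ∈ Ioo (0 : ℝ) (1 / 2), 1 - t ∈ Ioo (0 : ℝ) 1 := fun t ht =>
    ⟨by linarith [ht.2], by linarith [ht.1]⟩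
  have dr : ∀ (f : ℝ → ℝ) (t : ℝ), DifferentiableAt ℝ f (1 - t) →
      DifferentiableAt ℝ (fun s => f (1 - s)) t := fun f t hf =>
    DifferentiableAt.comp t hf (by fun_prop)
  have p12 : ∀ t ∈ Ioo (0 : ℝ) 1, 0 < y₁ t / y₂ t := fun t ht =>
    div_pos (hy₁pos t ht) (hy₂pos t ht)
  have p21 : ∀ t ∈ Ioo (0 : ℝ) 1, 0 < y₂ t / y₁ t := fun t ht =>
    div_pos (hy₂pos t ht) (hy₁pos t ht)
  have d12 : ∀ t ∈ Ioo (0 : ℝ) 1, DifferentiableAt ℝ (fun s => y₁ s / y₂ s) t := fun t ht =>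
    (hd₁ t ht).div (hd₂ t ht) (hy₂pos t ht).ne'
  have d21 : ∀ t ∈ Ioo (0 : ℝ) 1, DifferentiableAt ℝ (fun s => y₂ s / y₁ s) t := fun t ht =>
    (hd₂ t ht).div (hd₁ t ht) (hy₁pos t ht).ne'
  have qs : ∀ t ∈ Ioo (0 : ℝ) 1, 0 ≤ Real.sin (Real.pi * t / 2) ^ 2 / (y₁ t * y₂ t) :=
    fun t ht => div_nonneg (sq_nonneg _) (mul_pos (hy₁pos t ht) (hy₂pos t ht)).le
  have qc : ∀ t ∈ Ioo (0 : ℝ) 1, 0 ≤ Real.cos (Real.pi * t / 2) ^ 2 / (y₁ t * y₂ t) :=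
    fun t ht => div_nonneg (sq_nonneg _) (mul_pos (hy₁pos t ht) (hy₂pos t ht)).le
  obtain ⟨A, hA, HA⟩ := caseA (φ := fun s => y₁ s / y₂ s)
    (Q := fun t => Real.sin (Real.pi * t / 2) ^ 2 / (y₁ t * y₂ t)) (-1) 0
    (fun t ht => p12 t (i1 t ht)) (fun t ht => d12 t (i1 t ht)) (fun t ht => qs t (i1 t ht))
  obtain ⟨B, hB, HB⟩ := caseB (φ := fun s => y₂ s / y₁ s)
    (Q := fun t => Real.cos (Real.pi * t / 2) ^ 2 / (y₁ t * y₂ t)) 0 1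
    (fun t ht => p21 t (i1 t ht)) (fun t ht => d21 t (i1 t ht)) (fun t ht => qc t (i1 t ht))
  obtain ⟨C, hC, HC⟩ := caseB (φ := fun t => (fun s => y₁ s / y₂ s) (1 - t))
    (Q := fun t => (fun t => Real.sin (Real.pi * t / 2) ^ 2 / (y₁ t * y₂ t)) (1 - t)) 0 1
    (fun t ht => p12 _ (i2 t ht)) (fun t ht => dr _ t (d12 _ (i2 t ht)))
    (fun t ht => qs _ (i2 t ht))
  obtain ⟨D, hD, HD⟩ := caseA (φ := fun t => (fun s => y₂ s / y₁ s) (1 - t))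
    (Q := fun t => (fun t => Real.cos (Real.pi * t / 2) ^ 2 / (y₁ t * y₂ t)) (1 - t)) (-1) 0
    (fun t ht => p21 _ (i2 t ht)) (fun t ht => dr _ t (d21 _ (i2 t ht)))
    (fun t ht => qc _ (i2 t ht))
  have hh : (1 - 1 / 2 : ℝ) = 1 / 2 := by norm_num
  have h0m : (0 : ℝ) ∈ Icc (0 : ℝ) (1 / 2) := by constructor <;> norm_num
  refine ⟨A + B + C + D, by positivity, ?_, ?_, ?_, ?_⟩
  · intro α hα l hl hE h0 h1 h2
    exact HA α (by linarith) l ⟨⟨hl, fun t ht => by rw [hE t ht, mul_div_assoc]⟩, h0, h1, h2⟩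
  · intro α hα l hl hE h0 h1
    exact HB α (by linarith) l ⟨⟨hl, fun t ht => by rw [hE t ht, mul_div_assoc]⟩, h0, h1⟩
  · intro β hβ l hl hE h0 h1
    have S := sol_refl (φ := fun s => y₁ s / y₂ s)
      (Q := fun t => Real.sin (Real.pi * t / 2) ^ 2 / (y₁ t * y₂ t)) hl
      (fun t ht => by rw [hE t ht, mul_div_assoc])
    have hdf := hl.differentiableOn (by norm_num)
    have e1 := dw_refl h0m (hdf _ (maps_refl h0m))
    have := HC β (by linarith) _ ⟨S, by simp [h0], by rw [e1, sub_zero, h1]⟩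
    rw [hh] at this
    linarith
  · intro β hβ l hl hE h0 h1 h2
    have S := sol_refl (φ := fun s => y₂ s / y₁ s)
      (Q := fun t => Real.cos (Real.pi * t / 2) ^ 2 / (y₁ t * y₂ t)) hl
      (fun t ht => by rw [hE t ht, mul_div_assoc])
    have hdf := hl.differentiableOn (by norm_num)
    have e1 : ∀ x ∈ Icc (0 : ℝ) (1 / 2), derivWithin (fun t => - l (1 - t)) (Icc 0 (1 / 2)) x
        = - (fun s => - derivWithin l (Icc (1 / 2) 1) s) (1 - x) := fun x hx => by
      rw [dw_refl hx (hdf _ (maps_refl hx)), neg_neg]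
    have hd2 : DifferentiableOn ℝ (fun s => - derivWithin l (Icc (1 / 2) 1) s) (Icc (1 / 2) 1) :=
      ((derivWithin_C1 (by norm_num) hl).differentiableOn (by norm_num)).neg
    have e2 : derivWithin (derivWithin (fun t => - l (1 - t)) (Icc 0 (1 / 2))) (Icc 0 (1 / 2)) 0
        = β := by
      rw [derivWithin_congr e1 (e1 0 h0m), dw_refl (f := fun s => - derivWithin l (Icc (1 / 2) 1) s) h0m
        (hd2 _ (maps_refl h0m)), sub_zero,
        derivWithin.fun_neg, h2, neg_neg]
    have := HD β (by linarith) _ ⟨S, by simp [h0], by rw [e1 0 h0m]; simp only [sub_zero, h1, neg_zero], e2⟩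
    rw [hh] at this
    linarith
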